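/- (Corollary 1) Fix integers q ≥ 2, m ≥ 2, 0 ≤ n < m, a subset J = {j_1, …, j_n} ⊆ {1, …, m} of size n, and functions h_1, …, h_{m−n−1}, h'_1, …, h'_{m−n−1} : ℤ_q → ℤ_q. For each c ∈ ℤ_q^n choose a bijection π_c : {1, …, m−n} → {1, …, m} \ J and functions g^{(c)}_1, …, g^{(c)}_{m−n} : ℤ_q → ℤ_q, and define f : ℤ_q^m → ℤ_q so that whenever (x_{j_1}, …, x_{j_n}) = c one has f(x_1,…,x_m) = ∑_{i=1}^{m−n−1} h_i(x_{π_c(i)}) h'_i(x_{π_c(i+1)}) + ∑_{j=1}^{m−n} g^{(c)}_j(x_{π_c(j)}) + w(c), where w(c) ∈ ℤ_q is the reduction mod q of ∑_{i=1}^{n} c_i q^{n−i}. For t ∈ {0, …, q^{n+1}−1} with base-q digits t = ∑_{i=1}^{n+1} t_i q^{n+1−i}, let ψ(C_t) be the code whose sequences, indexed by (d_1,…,d_{n+1}) ∈ ℤ_q^{n+1}, have x-th entry ξ_q^{f(x_1,…,x_m) + ∑_{i=1}^{n}(d_i + t_i)·x_{j_i} + d_{n+1}·x_{π(1)} + t_{n+1}·x_{π(m−n)}},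 where π = π_c on the set of x with (x_{j_1},…,x_{j_n}) = c and (x_1,…,x_m) are the base-q digits of x ∈ {0, …, q^m−1}. Then the following are equivalent: (a) for every choice of the families (g^{(c)}_j) and (π_c), the family {ψ(C_t) : 0 ≤ t < q^{n+1}} is a (q^{n+1}, q^m)-CCC; (b) every h_i and every h'_i, 1 ≤ i ≤ m−n−1, is a permutation of ℤ_q. -/

import Mathlib

open scoped Classical

/-- Aperiodic cross-correlation function (ACCF) of two length-`L` complex sequences
at integer shift `τ`:
`Θ(a,b)(τ) = ∑_{t=0}^{L−τ−1} a_t · conj(b_{t+τ})` for `0 ≤ τ`, and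
`Θ(a,b)(τ) = ∑_{t=0}^{L+τ−1} a_{t−τ} · conj(b_t)` for `τ < 0`. -/
noncomputable def accf (L : ℕ) (a b : ℕ → ℂ) (τ : ℤ) : ℂ :=
  if 0 ≤ τ then
    ∑ t ∈ Finset.range (L - τ.toNat), a t * (starRingEnd ℂ) (b (t + τ.toNat))
  else
    ∑ t ∈ Finset.range (L - (-τ).toNat), a (t + (-τ).toNat) * (starRingEnd ℂ) (b t)

/-- ACCF (sum) of two codes, i.e. tuples of length-`L` sequences indexed by `κ`:
`Θ(C, C')(τ) = ∑_m Θ(c^m, c'^m)(τ)`. -/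
noncomputable def codeACCF {κ : Type*} [Fintype κ] (L : ℕ) (C C' : κ → ℕ → ℂ)
    (τ : ℤ) : ℂ :=
  ∑ m : κ, accf L (C m) (C' m) τ

/-- A family of codes `C_k` (`k : ι`), each a (`card κ`)-tuple of length-`L` sequences,
is a set of complete complementary codes (CCC) if the number of sequences per code equals
the number `K` of codes, `Θ(C_{k₁}, C_{k₂})(0) = K·L`, and all other aperiodic
auto/cross-correlation sums with `|τ| < L` vanish. -/
noncomputable def IsCCC {ι κ : Type*} [Fintype ι] [Fintype κ] (L : ℕ)
    (C : ι → κ → ℕ → ℂ) : Prop :=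
  Fintype.card κ = Fintype.card ι ∧
  ∀ k₁ k₂ : ι, ∀ τ : ℤ, |τ| < (L : ℤ) →
    codeACCF L (C k₁) (C k₂) τ =
      if τ = 0 ∧ k₁ = k₂ then ((Fintype.card ι : ℂ) * (L : ℂ)) else 0

/-- `ξ_q = exp(2πi/q)`, a primitive `q`-th root of unity. -/
noncomputable def xi (q : ℕ) : ℂ := Complex.exp (2 * Real.pi * Complex.I / q)

/-- The `(j+1)`-st base-`q` digit `x_{j+1}` of `x` (so `x = ∑_j x_{j+1} q^j`),
regarded as an element of `ℤ_q`. -/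
def dig (q x j : ℕ) : ZMod q := (((x / q ^ j) % q : ℕ) : ZMod q)

/-- The function `f(x_1,…,x_m) = ∑_{i=1}^{m−1} h_i(x_{π(i)}) h'_i(x_{π(i+1)})
+ ∑_{j=1}^m g_j(x_j)` evaluated at the base-`q` digit vector of `x ∈ {0,…,q^m−1}`.
Here indices are 0-based: `h i`, `h' i` stand for `h_{i+1}`, `h'_{i+1}`, and `π` is a
permutation of the `m` digit positions. -/
def qfun (q m : ℕ) (hm : 2 ≤ m) (h h' : Fin (m - 1) → ZMod q → ZMod q)
    (g : Fin m → ZMod q → ZMod q) (π : Equiv.Perm (Fin m)) (x : ℕ) : ZMod q :=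
  (∑ i : Fin (m - 1),
      h i (dig q x (π (Fin.castLE (by omega) i))) *
        h' i (dig q x (π (Fin.cast (by omega) i.succ)))) +
    ∑ j : Fin m, g j (dig q x j)

/-- `F_{x,t} = f(x_1,…,x_m) + t·x_{π(m)}`. -/
def Fqt (q m : ℕ) (hm : 2 ≤ m) (h h' : Fin (m - 1) → ZMod q → ZMod q)
    (g : Fin m → ZMod q → ZMod q) (π : Equiv.Perm (Fin m)) (x : ℕ) (t : ZMod q) :
    ZMod q :=
  qfun q m hm h h' g π x + t * dig q x (π ⟨m - 1, by omega⟩)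

/-- The code `ψ(C_t)`: its `d`-th sequence (`d ∈ ℤ_q`) has `x`-th entry
`ξ_q^{f(x_1,…,x_m) + d·x_{π(1)} + t·x_{π(m)}}`. -/
noncomputable def psiC (q m : ℕ) (hm : 2 ≤ m) (h h' : Fin (m - 1) → ZMod q → ZMod q)
    (g : Fin m → ZMod q → ZMod q) (π : Equiv.Perm (Fin m)) (t : ZMod q) :
    ZMod q → ℕ → ℂ :=
  fun d x =>
    xi q ^ (Fqt q m hm h h' g π x t + d * dig q x (π ⟨0, by omega⟩)).val

/-- `w(c)`: the reduction mod `q` of `∑_{i=1}^{n} c_i q^{n−i}`. -/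
def wconst (q n : ℕ) (c : Fin n → ZMod q) : ZMod q :=
  ((∑ i : Fin n, (c i).val * q ^ (n - 1 - (i : ℕ)) : ℕ) : ZMod q)

/-- The function `f : ℤ_q^m → ℤ_q` (evaluated on the base-`q` digit vector of
`x ∈ {0,…,q^m−1}`), whose restriction to `x_J = c` is
`∑_{i=1}^{m−n−1} h_i(x_{π_c(i)}) h'_i(x_{π_c(i+1)}) + ∑_{j=1}^{m−n} g^{(c)}_j(x_{π_c(j)}) + w(c)`.
Here `J` lists the `n` restricted positions and, for each `c ∈ ℤ_q^n`, `πc c` maps the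
`m−n` free slots to digit positions. -/
def rfun (q m n : ℕ) (hm : 2 ≤ m) (hn : n < m) (J : Fin n → Fin m)
    (h h' : Fin (m - n - 1) → ZMod q → ZMod q)
    (g : (Fin n → ZMod q) → Fin (m - n) → ZMod q → ZMod q)
    (πc : (Fin n → ZMod q) → Fin (m - n) → Fin m) (x : ℕ) : ZMod q :=
  let c : Fin n → ZMod q := fun i => dig q x (J i)
  (∑ i : Fin (m - n - 1),
      h i (dig q x (πc c (Fin.castLE (by omega) i))) *
        h' i (dig q x (πc c (Fin.cast (by omega) i.succ)))) +
    (∑ j : Fin (m - n), g c j (dig q x (πc c j))) + wconst q n c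

/-- The code `ψ(C_t)` for `0 ≤ t < q^{n+1}` with base-`q` digits
`t = ∑_{i=1}^{n+1} t_i q^{n+1−i}`: its sequences are indexed by
`(d_1,…,d_{n+1}) ∈ ℤ_q^{n+1}` and have `x`-th entry
`ξ_q^{f(x) + ∑_{i=1}^{n}(d_i + t_i)x_{j_i} + d_{n+1}x_{π_c(1)} + t_{n+1}x_{π_c(m−n)}}`,
where `c` consists of the `J`-digits of `x`. -/
noncomputable def psiR (q m n : ℕ) (hm : 2 ≤ m) (hn : n < m) (J : Fin n → Fin m)
    (h h' : Fin (m - n - 1) → ZMod q → ZMod q)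
    (g : (Fin n → ZMod q) → Fin (m - n) → ZMod q → ZMod q)
    (πc : (Fin n → ZMod q) → Fin (m - n) → Fin m) (t : ℕ) :
    (Fin (n + 1) → ZMod q) → ℕ → ℂ :=
  fun d x =>
    let c : Fin n → ZMod q := fun i => dig q x (J i)
    xi q ^ (rfun q m n hm hn J h h' g πc x +
        (∑ i : Fin n, (d i.castSucc + dig q t (n - (i : ℕ))) * dig q x (J i)) +
        d (Fin.last n) * dig q x (πc c ⟨0, by omega⟩) +
        dig q t 0 * dig q x (πc c ⟨m - n - 1, by omega⟩)).val

section DigitVectors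

variable {q m : ℕ} [NeZero q]

/-- The bijection between digit vectors in `ℤ_q^m` and `{0, …, q^m − 1}`. -/
def digitEquiv (q m : ℕ) [NeZero q] : (Fin m → ZMod q) ≃ Fin (q ^ m) :=
  (Equiv.piCongrRight fun _ =>
    { toFun := fun z => (⟨z.val, ZMod.val_lt z⟩ : Fin q)
      invFun := fun i => ((i : ℕ) : ZMod q)
      left_inv := fun z => ZMod.natCast_zmod_val z
      right_inv := fun i => Fin.ext (ZMod.val_cast_of_lt i.isLt) }).trans finFunctionFinEquiv

lemma digitEquiv_val (x : Fin m → ZMod q) :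
    (digitEquiv q m x : ℕ) = ∑ i, (x i).val * q ^ (i : ℕ) := by
  simp [digitEquiv]

lemma dig_digitEquiv (x : Fin m → ZMod q) (i : Fin m) : dig q (digitEquiv q m x) i = x i := by
  have h := congrFun ((digitEquiv q m).symm_apply_apply x) i
  rw [← h]
  generalize digitEquiv q m x = k
  simp [dig, digitEquiv]

lemma digitEquiv_sub (x y : Fin m → ZMod q) :
    ((digitEquiv q m y : ℕ) : ℤ) - (digitEquiv q m x : ℕ)
      = ∑ i, (((y i).val : ℤ) - (x i).val) * (q : ℤ) ^ (i : ℕ) := by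
  rw [digitEquiv_val, digitEquiv_val]
  push_cast
  rw [← Finset.sum_sub_distrib]
  exact Finset.sum_congr rfl fun i _ => by ring

lemma digitEquiv_sub_shift {x y : Fin m → ZMod q} {p : Fin m} (hp : x p = y p) (z : ZMod q) :
    ((digitEquiv q m (y + Pi.single p z) : ℕ) : ℤ) - (digitEquiv q m (x + Pi.single p z) : ℕ)
      = ((digitEquiv q m y : ℕ) : ℤ) - (digitEquiv q m x : ℕ) := by
  rw [digitEquiv_sub, digitEquiv_sub]
  refine Finset.sum_congr rfl fun i _ => ?_
  by_cases hi : i = p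
  · subst hi
    simp [hp]
  · simp [hi]

lemma sum_range_digitEquiv (f : ℕ → ℂ) :
    ∑ k ∈ Finset.range (q ^ m), f k = ∑ x : Fin m → ZMod q, f (digitEquiv q m x) := by
  rw [Finset.sum_range]
  exact ((digitEquiv q m).sum_comp fun k => f k).symm

lemma accf_eq_sum_ite (L : ℕ) (a b : ℕ → ℂ) (τ : ℤ) :
    accf L a b τ = ∑ s ∈ Finset.range L, ∑ t ∈ Finset.range L,
      if (t : ℤ) - s = τ then a s * (starRingEnd ℂ) (b t) else 0 := by
  unfold accf
  split_ifs with hτ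
  · obtain ⟨k, rfl⟩ := Int.eq_ofNat_of_zero_le hτ
    have key : ∀ s ∈ Finset.range L, (∑ t ∈ Finset.range L,
        if (t : ℤ) - s = k then a s * (starRingEnd ℂ) (b t) else 0)
        = if s ∈ Finset.range (L - k) then a s * (starRingEnd ℂ) (b (s + k)) else 0 := by
      intro s _
      have : ∀ t : ℕ, ((t : ℤ) - s = k) ↔ t = s + k := fun t => by omega
      simp only [this, Finset.sum_ite_eq', Finset.mem_range]
      exact if_congr (by omega) rfl rfl
    rw [Finset.sum_congr rfl key, Finset.sum_ite_mem, Int.toNat_natCast,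
      Finset.inter_eq_right.2 (Finset.range_mono (Nat.sub_le L k))]
  · obtain ⟨k, hk⟩ := Int.eq_ofNat_of_zero_le (show 0 ≤ -τ by omega)
    have key : ∀ t ∈ Finset.range L, (∑ s ∈ Finset.range L,
        if (t : ℤ) - s = τ then a s * (starRingEnd ℂ) (b t) else 0)
        = if t ∈ Finset.range (L - k) then a (t + k) * (starRingEnd ℂ) (b t) else 0 := by
      intro t _
      have : ∀ s : ℕ, ((t : ℤ) - s = τ) ↔ s = t + k := fun s => by omega
      simp only [this, Finset.sum_ite_eq', Finset.mem_range]
      exact if_congr (by omega) rfl rfl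
    rw [Finset.sum_comm, Finset.sum_congr rfl key, Finset.sum_ite_mem, hk, Int.toNat_natCast,
      Finset.inter_eq_right.2 (Finset.range_mono (Nat.sub_le L k))]

lemma codeACCF_eq_sum_pairs {κ : Type*} [Fintype κ] (C C' : κ → ℕ → ℂ) (τ : ℤ) :
    codeACCF (q ^ m) C C' τ = ∑ a : (Fin m → ZMod q) × (Fin m → ZMod q),
      if ((digitEquiv q m a.2 : ℕ) : ℤ) - (digitEquiv q m a.1 : ℕ) = τ then
        ∑ d, C d (digitEquiv q m a.1) * (starRingEnd ℂ) (C' d (digitEquiv q m a.2)) else 0 := by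
  simp only [codeACCF, accf_eq_sum_ite, sum_range_digitEquiv, Fintype.sum_prod_type]
  rw [Finset.sum_comm]
  refine Finset.sum_congr rfl fun x _ => ?_
  rw [Finset.sum_comm]
  refine Finset.sum_congr rfl fun y _ => ?_
  split_ifs <;> simp

end DigitVectors

section CharacterSums

variable {q : ℕ} [NeZero q]

lemma xi_pow_val (a : ZMod q) : xi q ^ a.val = ZMod.stdAddChar a := by
  rw [ZMod.stdAddChar_apply, ZMod.toCircle_apply, xi, ← Complex.exp_nat_mul]
  congr 1
  ring

lemma sum_stdAddChar_mul {δ : ZMod q} (hδ : δ ≠ 0) :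
    ∑ z : ZMod q, ZMod.stdAddChar (z * δ) = (0 : ℂ) := by
  rw [AddChar.sum_mulShift δ (ZMod.isPrimitive_stdAddChar q), if_neg hδ, Nat.cast_zero]

lemma sum_stdAddChar_dotProduct {ι : Type*} [Fintype ι] [DecidableEq ι] (u : ι → ZMod q) :
    ∑ d : ι → ZMod q, (ZMod.stdAddChar (∑ i, d i * u i) : ℂ)
      = if u = 0 then (q : ℂ) ^ Fintype.card ι else 0 := by
  have h : ∀ d : ι → ZMod q, (ZMod.stdAddChar (∑ i, d i * u i) : ℂ)
      = ∏ i, ZMod.stdAddChar (d i * u i) := fun d =>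
    map_prod (ZMod.stdAddChar (N := q)).toMonoidHom (fun i => Multiplicative.ofAdd (d i * u i)) _
  simp only [h]
  rw [← Fintype.piFinset_univ, ← Finset.prod_univ_sum (fun _ => Finset.univ)
    fun i z => (ZMod.stdAddChar (z * u i) : ℂ)]
  split_ifs with hu
  · simp [hu]
  · obtain ⟨i, hi⟩ := Function.ne_iff.1 hu
    exact Finset.prod_eq_zero (Finset.mem_univ i) (sum_stdAddChar_mul hi)

/-- A sum vanishes as soon as it vanishes along the orbits of a family of bijections. -/
lemma sum_eq_zero_of_sum_shift {α : Type*} [Fintype α] (T : ZMod q → α → α)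
    (hT : ∀ z, Function.Bijective (T z)) (F : α → ℂ) (hF : ∀ a, ∑ z, F (T z a) = 0) :
    ∑ a, F a = 0 := by
  have h : (q : ℂ) * ∑ a, F a = 0 := by
    calc (q : ℂ) * ∑ a, F a = ∑ z : ZMod q, ∑ a, F (T z a) := by
          simp only [(hT _).sum_comp F]
          simp
      _ = 0 := by
          rw [Finset.sum_comm]
          exact Finset.sum_eq_zero fun a _ => hF a
  exact (mul_eq_zero.1 h).resolve_left (Nat.cast_ne_zero.2 (NeZero.ne q))

lemma sum_stdAddChar_comp_mul {h : ZMod q → ZMod q} (hh : Function.Bijective h) {δ : ZMod q}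
    (hδ : δ ≠ 0) : ∑ z, ZMod.stdAddChar (h z * δ) = (0 : ℂ) := by
  rw [hh.sum_comp fun w => (ZMod.stdAddChar (w * δ) : ℂ)]
  exact sum_stdAddChar_mul hδ

lemma bijective_of_sum_stdAddChar {h : ZMod q → ZMod q}
    (hh : ∀ δ ≠ 0, ∑ z, ZMod.stdAddChar (h z * δ) = (0 : ℂ)) : Function.Bijective h := by
  rw [← Finite.surjective_iff_bijective]
  intro w
  by_contra! hw
  have h1 : ∑ δ : ZMod q, ∑ z, (ZMod.stdAddChar (δ * (h z - w)) : ℂ) = 0 := by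
    rw [Finset.sum_comm]
    exact Finset.sum_eq_zero fun z _ => sum_stdAddChar_mul (sub_ne_zero.2 (hw z))
  rw [Finset.sum_eq_single 0] at h1
  · simp at h1
    exact NeZero.ne q h1
  · intro δ _ hδ
    have h2 : ∀ z, (ZMod.stdAddChar (δ * (h z - w)) : ℂ)
        = ZMod.stdAddChar (h z * δ) * ZMod.stdAddChar (-(w * δ)) := fun z => by
      rw [← AddChar.map_add_eq_mul]
      congr 1
      ring
    simp only [h2]
    rw [← Finset.sum_mul, hh δ hδ, zero_mul]
  · simp

/-- If `∑_z χ(h(z)(h'(a) − h'(b)))` vanishes whenever `a < b`, both functions are permutations. -/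
lemma bijective_of_sum_stdAddChar_sub {h h' : ZMod q → ZMod q}
    (H : ∀ a b : ZMod q, a.val < b.val →
      ∑ z, ZMod.stdAddChar (h z * (h' a - h' b)) = (0 : ℂ)) :
    Function.Bijective h ∧ Function.Bijective h' := by
  have H' : ∀ a b : ZMod q, a ≠ b →
      ∑ z, ZMod.stdAddChar (h z * (h' a - h' b)) = (0 : ℂ) := by
    intro a b hab
    rcases lt_or_gt_of_ne (fun e => hab (ZMod.val_injective q e)) with hlt | hlt
    · exact H a b hlt
    · have h0 := congrArg (starRingEnd ℂ) (H b a hlt)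
      rw [map_sum, map_zero] at h0
      rw [← h0]
      refine Finset.sum_congr rfl fun z _ => ?_
      rw [← AddChar.map_neg_eq_conj]
      congr 1
      ring
  have hinj : Function.Injective h' := by
    intro a b hab
    by_contra hne
    have h0 := H' a b hne
    simp [hab] at h0
    exact NeZero.ne q h0
  have hbij := Finite.injective_iff_bijective.1 hinj
  refine ⟨bijective_of_sum_stdAddChar fun δ hδ => ?_, hbij⟩
  obtain ⟨a, ha⟩ := hbij.2 (h' 0 + δ)
  have hne : a ≠ 0 := by
    rintro rfl
    exact hδ (by simpa using ha)
  have h0 := H' a 0 hne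
  rwa [ha, add_sub_cancel_left] at h0

end CharacterSums

section ChainSums

variable {q : ℕ}

/-- The sum `∑_i h_i(u_i) h'_i(u_{i+1})` along a path of `N` vertices. -/
def chainSum {N : ℕ} (h h' : Fin (N - 1) → ZMod q → ZMod q) (u : Fin N → ZMod q) : ZMod q :=
  ∑ i : Fin (N - 1), h i (u ⟨i, by omega⟩) * h' i (u ⟨i + 1, by omega⟩)

lemma chainSum_sub {N : ℕ} (h h' : Fin (N - 1) → ZMod q → ZMod q) (v : Fin (N - 1))
    {u w u₀ w₀ : Fin N → ZMod q}
    (huw : ∀ j : Fin N, (j : ℕ) ≤ v → u j = w j)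
    (huw₀ : ∀ j : Fin N, (j : ℕ) ≤ v → u₀ j = w₀ j)
    (hgt : ∀ j : Fin N, (v : ℕ) < j → u j = u₀ j ∧ w j = w₀ j) :
    chainSum h h' u - chainSum h h' w = chainSum h h' u₀ - chainSum h h' w₀
      + (h v (u ⟨v, by omega⟩) - h v (u₀ ⟨v, by omega⟩))
        * (h' v (u₀ ⟨v + 1, by omega⟩) - h' v (w₀ ⟨v + 1, by omega⟩)) := by
  rw [← sub_eq_iff_eq_add']
  simp only [chainSum, ← Finset.sum_sub_distrib]
  rw [Finset.sum_eq_single v]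
  · rw [(hgt ⟨v + 1, by omega⟩ (Nat.lt_succ_self _)).1,
      (hgt ⟨v + 1, by omega⟩ (Nat.lt_succ_self _)).2,
      huw ⟨v, by omega⟩ le_rfl, huw₀ ⟨v, by omega⟩ le_rfl]
    ring
  · intro i _ hi
    rcases lt_or_gt_of_ne hi with hlt | hlt
    · have hlt' : (i : ℕ) < v := hlt
      rw [huw ⟨i, by omega⟩ hlt'.le, huw ⟨i + 1, by omega⟩ hlt',
        huw₀ ⟨i, by omega⟩ hlt'.le, huw₀ ⟨i + 1, by omega⟩ hlt']
      ring
    · have hlt' : (v : ℕ) < i := hlt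
      rw [(hgt ⟨i, by omega⟩ hlt').1, (hgt ⟨i, by omega⟩ hlt').2,
        (hgt ⟨i + 1, by omega⟩ (hlt'.trans (Nat.lt_succ_self _))).1,
        (hgt ⟨i + 1, by omega⟩ (hlt'.trans (Nat.lt_succ_self _))).2]
      ring
  · simp

end ChainSums

section Correlations

variable {q m n : ℕ}

/-- The part of the phase of `psiR` that does not depend on the sequence index, as a function of
the digit vector. -/
def phase (hn : n < m) (J : Fin n → Fin m) (h h' : Fin (m - n - 1) → ZMod q → ZMod q)
    (g : (Fin n → ZMod q) → Fin (m - n) → ZMod q → ZMod q)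
    (πc : (Fin n → ZMod q) → Fin (m - n) → Fin m) (s : Fin n → ZMod q) (r : ZMod q)
    (x : Fin m → ZMod q) : ZMod q :=
  chainSum h h' (x ∘ πc (x ∘ J)) + ∑ j, g (x ∘ J) j (x (πc (x ∘ J) j)) + wconst q n (x ∘ J)
    + ∑ i, s i * x (J i) + r * x (πc (x ∘ J) ⟨m - n - 1, by omega⟩)

/-- The digits of `x` multiplied by the sequence index in the phase of `psiR`. -/
def indexDigits (hn : n < m) (J : Fin n → Fin m)
    (πc : (Fin n → ZMod q) → Fin (m - n) → Fin m) (x : Fin m → ZMod q) : Fin (n + 1) → ZMod q :=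
  Fin.snoc (α := fun _ => ZMod q) (x ∘ J) (x (πc (x ∘ J) ⟨0, by omega⟩))

lemma indexDigits_eq_iff (hn : n < m) (J : Fin n → Fin m)
    (πc : (Fin n → ZMod q) → Fin (m - n) → Fin m) (x y : Fin m → ZMod q) :
    indexDigits hn J πc x = indexDigits hn J πc y ↔
      x ∘ J = y ∘ J ∧ x (πc (x ∘ J) ⟨0, by omega⟩) = y (πc (x ∘ J) ⟨0, by omega⟩) := by
  unfold indexDigits
  rw [Fin.snoc_inj]
  constructor
  · rintro ⟨h1, h2⟩
    exact ⟨h1, by rw [h2, h1]⟩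
  · rintro ⟨h1, h2⟩
    exact ⟨h1, by rw [h2, h1]⟩

variable [NeZero q]

lemma psiR_digitEquiv (hm : 2 ≤ m) (hn : n < m) (J : Fin n → Fin m)
    (h h' : Fin (m - n - 1) → ZMod q → ZMod q)
    (g : (Fin n → ZMod q) → Fin (m - n) → ZMod q → ZMod q)
    (πc : (Fin n → ZMod q) → Fin (m - n) → Fin m) (t : ℕ) (d : Fin (n + 1) → ZMod q)
    (x : Fin m → ZMod q) :
    psiR q m n hm hn J h h' g πc t d (digitEquiv q m x)
      = ZMod.stdAddChar (phase hn J h h' g πc (fun i => dig q t (n - i)) (dig q t 0) x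
          + ∑ i, d i * indexDigits hn J πc x i) := by
  unfold psiR rfun
  simp only [dig_digitEquiv, xi_pow_val]
  congr 1
  simp only [phase, chainSum, indexDigits, Fin.sum_univ_castSucc, Fin.snoc_castSucc,
    Fin.snoc_last, add_mul, Finset.sum_add_distrib]
  simp only [Function.comp_def]
  have e : ∀ i : Fin (m - n - 1), Fin.castLE (show m - n - 1 ≤ m - n by omega) i
      = ⟨i, by omega⟩ := fun i => rfl
  have e' : ∀ i : Fin (m - n - 1), Fin.cast (show m - n - 1 + 1 = m - n by omega) i.succ
      = ⟨i + 1, by omega⟩ := fun i => rfl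
  simp only [e, e']
  ring

lemma codeACCF_psiR (hm : 2 ≤ m) (hn : n < m) (J : Fin n → Fin m)
    (h h' : Fin (m - n - 1) → ZMod q → ZMod q)
    (g : (Fin n → ZMod q) → Fin (m - n) → ZMod q → ZMod q)
    (πc : (Fin n → ZMod q) → Fin (m - n) → Fin m) (t t' : ℕ) (τ : ℤ) :
    codeACCF (q ^ m) (psiR q m n hm hn J h h' g πc t) (psiR q m n hm hn J h h' g πc t') τ
      = (q : ℂ) ^ (n + 1) * ∑ a : (Fin m → ZMod q) × (Fin m → ZMod q),
        if ((digitEquiv q m a.2 : ℕ) : ℤ) - (digitEquiv q m a.1 : ℕ) = τ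
            ∧ indexDigits hn J πc a.1 = indexDigits hn J πc a.2 then
          (ZMod.stdAddChar (phase hn J h h' g πc (fun i => dig q t (n - i)) (dig q t 0) a.1
            - phase hn J h h' g πc (fun i => dig q t' (n - i)) (dig q t' 0) a.2) : ℂ)
        else 0 := by
  rw [codeACCF_eq_sum_pairs, Finset.mul_sum]
  refine Finset.sum_congr rfl fun a _ => ?_
  by_cases hτ : ((digitEquiv q m a.2 : ℕ) : ℤ) - (digitEquiv q m a.1 : ℕ) = τ
  swap
  · simp [hτ]
  simp only [hτ, if_true, true_and, psiR_digitEquiv]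
  generalize phase hn J h h' g πc (fun i => dig q t (n - i)) (dig q t 0) a.1 = A
  generalize phase hn J h h' g πc (fun i => dig q t' (n - i)) (dig q t' 0) a.2 = B
  have e : ∀ d : Fin (n + 1) → ZMod q,
      (ZMod.stdAddChar (A + ∑ i, d i * indexDigits hn J πc a.1 i) : ℂ)
        * (starRingEnd ℂ) (ZMod.stdAddChar (B + ∑ i, d i * indexDigits hn J πc a.2 i))
      = ZMod.stdAddChar (A - B) * ZMod.stdAddChar
          (∑ i, d i * (indexDigits hn J πc a.1 - indexDigits hn J πc a.2) i) := by
    intro d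
    rw [← AddChar.map_neg_eq_conj, ← AddChar.map_add_eq_mul, ← AddChar.map_add_eq_mul]
    congr 1
    simp only [Pi.sub_apply, mul_sub, Finset.sum_sub_distrib]
    ring
  simp only [e]
  rw [← Finset.mul_sum, sum_stdAddChar_dotProduct]
  simp only [sub_eq_zero, Fintype.card_fin]
  split_ifs
  · ring
  · simp

end Correlations

section Sufficiency

variable {q m n : ℕ}

lemma comp_add_single {J : Fin n → Fin m} {p : Fin m} (hp : ∀ i, p ≠ J i) (x : Fin m → ZMod q)
    (z : ZMod q) : (x + Pi.single p z) ∘ J = x ∘ J := by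
  funext i
  simp [Pi.single_eq_of_ne (hp i).symm]

lemma sumElim_bijective (hn : n < m) {J : Fin n → Fin m} (hJ : Function.Injective J)
    {π : Fin (m - n) → Fin m} (hπ : Function.Injective π) (hπJ : ∀ i j, π i ≠ J j) :
    Function.Bijective (Sum.elim J π) := by
  rw [Fintype.bijective_iff_injective_and_card]
  exact ⟨hJ.sumElim hπ fun i j => (hπJ j i).symm, by simp; omega⟩

lemma exists_eq_of_forall_ne (hn : n < m) {J : Fin n → Fin m} (hJ : Function.Injective J)
    {π : Fin (m - n) → Fin m} (hπ : Function.Injective π) (hπJ : ∀ i j, π i ≠ J j)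
    {p : Fin m} (hp : ∀ i, p ≠ J i) : ∃ j, π j = p := by
  obtain ⟨i | j, hij⟩ := (sumElim_bijective hn hJ hπ hπJ).2 p
  · exact (hp i hij.symm).elim
  · exact ⟨j, hij⟩

/-- Shifting the digit preceding the first disagreement of `x` and `y` changes the difference of
phases only through `h_v`. -/
lemma phase_sub_shift (hn : n < m) {J : Fin n → Fin m}
    (h h' : Fin (m - n - 1) → ZMod q → ZMod q)
    (g : (Fin n → ZMod q) → Fin (m - n) → ZMod q → ZMod q)
    {πc : (Fin n → ZMod q) → Fin (m - n) → Fin m}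
    (hπ : ∀ c, Function.Injective (πc c)) (hπJ : ∀ c i j, πc c i ≠ J j)
    (s s' : Fin n → ZMod q) (r r' : ZMod q) {x y : Fin m → ZMod q} (hxy : x ∘ J = y ∘ J)
    (v : Fin (m - n - 1))
    (hv : ∀ j : Fin (m - n), (j : ℕ) ≤ v → x (πc (x ∘ J) j) = y (πc (x ∘ J) j)) (z : ZMod q) :
    phase hn J h h' g πc s r (x + Pi.single (πc (x ∘ J) ⟨v, by omega⟩) z)
        - phase hn J h h' g πc s' r' (y + Pi.single (πc (x ∘ J) ⟨v, by omega⟩) z)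
      = phase hn J h h' g πc s r x - phase hn J h h' g πc s' r' y
        + (h v (x (πc (x ∘ J) ⟨v, by omega⟩) + z) - h v (x (πc (x ∘ J) ⟨v, by omega⟩)))
          * (h' v (x (πc (x ∘ J) ⟨v + 1, by omega⟩))
            - h' v (y (πc (x ∘ J) ⟨v + 1, by omega⟩))) := by
  have hpJ : ∀ i, πc (x ∘ J) ⟨v, by omega⟩ ≠ J i := fun i => hπJ _ _ i
  have hne : ∀ (w : Fin m → ZMod q) (j : Fin (m - n)), (j : ℕ) ≠ v →
      (w + Pi.single (πc (x ∘ J) ⟨v, by omega⟩) z : Fin m → ZMod q) (πc (x ∘ J) j)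
        = w (πc (x ∘ J) j) := by
    intro w j hj
    have : πc (x ∘ J) j ≠ πc (x ∘ J) ⟨v, by omega⟩ :=
      fun e => hj (congrArg Fin.val (hπ _ e))
    simp [Pi.single_eq_of_ne this]
  have hneJ : ∀ (w : Fin m → ZMod q) (i : Fin n),
      (w + Pi.single (πc (x ∘ J) ⟨v, by omega⟩) z : Fin m → ZMod q) (J i) = w (J i) :=
    fun w i => congrFun (comp_add_single hpJ w z) i
  have hchain := chainSum_sub h h' v
    (u := (x + Pi.single (πc (x ∘ J) ⟨v, by omega⟩) z) ∘ πc (x ∘ J))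
    (w := (y + Pi.single (πc (x ∘ J) ⟨v, by omega⟩) z) ∘ πc (x ∘ J))
    (u₀ := x ∘ πc (x ∘ J)) (w₀ := y ∘ πc (x ∘ J))
    (fun j hj => by simp [hv j hj]) hv fun j hj => by
      exact ⟨hne x j hj.ne', hne y j hj.ne'⟩
  have hg : ∑ j, g (x ∘ J) j
        ((x + Pi.single (πc (x ∘ J) ⟨v, by omega⟩) z : Fin m → ZMod q) (πc (x ∘ J) j))
      - ∑ j, g (x ∘ J) j
        ((y + Pi.single (πc (x ∘ J) ⟨v, by omega⟩) z : Fin m → ZMod q) (πc (x ∘ J) j))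
      = ∑ j, g (x ∘ J) j (x (πc (x ∘ J) j)) - ∑ j, g (x ∘ J) j (y (πc (x ∘ J) j)) := by
    rw [← Finset.sum_sub_distrib, ← Finset.sum_sub_distrib]
    refine Finset.sum_congr rfl fun j _ => ?_
    by_cases hj : (j : ℕ) = v
    · simp [hv j hj.le]
    · rw [hne x j hj, hne y j hj]
  have hlast : ((⟨m - n - 1, by omega⟩ : Fin (m - n)) : ℕ) ≠ v := by
    have := v.isLt
    simp only
    omega
  simp only [phase, comp_add_single hpJ, ← hxy, hneJ, hne _ _ hlast]
  simp only [Function.comp_apply, Pi.add_apply, Pi.single_eq_same] at hchain hg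
  have hchain' := sub_eq_iff_eq_add.1 hchain
  have hg' := sub_eq_iff_eq_add.1 hg
  simp only [Pi.add_apply]
  rw [hchain', hg']
  ring

variable [NeZero q]

lemma eq_of_dig_eq {N t t' : ℕ} (ht : t < q ^ N) (ht' : t' < q ^ N)
    (h : ∀ i < N, dig q t i = dig q t' i) : t = t' := by
  obtain ⟨x, hx⟩ := (digitEquiv q N).surjective ⟨t, ht⟩
  obtain ⟨y, hy⟩ := (digitEquiv q N).surjective ⟨t', ht'⟩
  have hx' : t = (digitEquiv q N x : ℕ) := by rw [hx]
  have hy' : t' = (digitEquiv q N y : ℕ) := by rw [hy]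
  have hxy : x = y := by
    funext i
    rw [← dig_digitEquiv x i, ← dig_digitEquiv y i, ← hx', ← hy', h i i.isLt]
  rw [hx', hy', hxy]

lemma sum_stdAddChar_phase_sub_eq_zero (hn : n < m) {J : Fin n → Fin m}
    (hJ : Function.Injective J) (h h' : Fin (m - n - 1) → ZMod q → ZMod q)
    (g : (Fin n → ZMod q) → Fin (m - n) → ZMod q → ZMod q)
    {πc : (Fin n → ZMod q) → Fin (m - n) → Fin m} (hπJ : ∀ c i j, πc c i ≠ J j)
    {s s' : Fin n → ZMod q} {r r' : ZMod q} (hne : ¬ (s = s' ∧ r = r')) :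
    ∑ x, (ZMod.stdAddChar (phase hn J h h' g πc s r x - phase hn J h h' g πc s' r' x) : ℂ)
      = 0 := by
  have hsub : ∀ x, phase hn J h h' g πc s r x - phase hn J h h' g πc s' r' x
      = ∑ i, (s i - s' i) * x (J i) + (r - r') * x (πc (x ∘ J) ⟨m - n - 1, by omega⟩) := by
    intro x
    simp only [phase, sub_mul, Finset.sum_sub_distrib]
    ring
  simp only [hsub]
  by_cases hr : r = r'
  · have hs : s ≠ s' := fun e => hne ⟨e, hr⟩
    obtain ⟨i, hi⟩ := Function.ne_iff.1 hs
    refine sum_eq_zero_of_sum_shift (fun z x => x + Pi.single (J i) z)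
      (fun z => (Equiv.addRight _).bijective) _ fun x => ?_
    have e : ∀ z, ∑ k, (s k - s' k) * (x + Pi.single (J i) z : Fin m → ZMod q) (J k)
        = ∑ k, (s k - s' k) * x (J k) + z * (s i - s' i) := by
      intro z
      simp only [Pi.add_apply, mul_add, Finset.sum_add_distrib]
      congr 1
      rw [Finset.sum_eq_single i]
      · simp [mul_comm]
      · intro k _ hk
        simp [Pi.single_eq_of_ne (hJ.ne hk)]
      · simp
    simp only [hr, sub_self, zero_mul, add_zero, e, AddChar.map_add_eq_mul]
    rw [← Finset.mul_sum, sum_stdAddChar_mul (sub_ne_zero.2 hi), mul_zero]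
  · have hcomp : ∀ (x : Fin m → ZMod q) (z : ZMod q),
        (x + Pi.single (πc (x ∘ J) ⟨m - n - 1, by omega⟩) z) ∘ J = x ∘ J := fun x z =>
      comp_add_single (fun i => hπJ _ _ i) x z
    refine sum_eq_zero_of_sum_shift
      (fun z x => x + Pi.single (πc (x ∘ J) ⟨m - n - 1, by omega⟩) z) (fun z => ?_) _ fun x => ?_
    · refine Finite.injective_iff_bijective.1 fun x y hxy => ?_
      have hc : x ∘ J = y ∘ J := by
        rw [← hcomp x z, ← hcomp y z]
        exact congrArg (· ∘ J) hxy
      simp only [hc] at hxy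
      exact add_right_cancel hxy
    · have e : ∀ z i, (x + Pi.single (πc (x ∘ J) ⟨m - n - 1, by omega⟩) z : Fin m → ZMod q) (J i)
          = x (J i) := fun z i => congrFun (hcomp x z) i
      simp only [hcomp, e]
      simp only [Pi.add_apply, Pi.single_eq_same, mul_add, AddChar.map_add_eq_mul]
      rw [← Finset.mul_sum, ← Finset.mul_sum]
      simp only [mul_comm (r - r')]
      rw [sum_stdAddChar_mul (sub_ne_zero.2 hr), mul_zero, mul_zero]

lemma sum_stdAddChar_phase_pairs_eq_zero (hn : n < m) {J : Fin n → Fin m}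
    (hJ : Function.Injective J) {h h' : Fin (m - n - 1) → ZMod q → ZMod q}
    (hh : ∀ i, Function.Bijective (h i) ∧ Function.Bijective (h' i))
    (g : (Fin n → ZMod q) → Fin (m - n) → ZMod q → ZMod q)
    {πc : (Fin n → ZMod q) → Fin (m - n) → Fin m}
    (hπ : ∀ c, Function.Injective (πc c)) (hπJ : ∀ c i j, πc c i ≠ J j)
    (s s' : Fin n → ZMod q) (r r' : ZMod q) {τ : ℤ} (hτ : τ ≠ 0) :
    (∑ a : (Fin m → ZMod q) × (Fin m → ZMod q),
        if ((digitEquiv q m a.2 : ℕ) : ℤ) - (digitEquiv q m a.1 : ℕ) = τ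
            ∧ indexDigits hn J πc a.1 = indexDigits hn J πc a.2 then
          (ZMod.stdAddChar (phase hn J h h' g πc s r a.1
            - phase hn J h h' g πc s' r' a.2) : ℂ)
        else 0) = 0 := by
  let IsFirst (c : Fin n → ZMod q) (E : Set (Fin m)) (v : Fin (m - n - 1)) : Prop :=
    (∀ j : Fin (m - n), (j : ℕ) ≤ v → πc c j ∈ E) ∧ πc c ⟨v + 1, by omega⟩ ∉ E
  have hP : ∀ (c : Fin n → ZMod q) (E : Set (Fin m)), ∃ p, p ∈ Set.range (πc c) ∧
      ((∃ v, IsFirst c E v) → ∃ v, IsFirst c E v ∧ p = πc c ⟨v, by omega⟩) := by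
    intro c E
    by_cases hv : ∃ v, IsFirst c E v
    · obtain ⟨v, hv⟩ := hv
      exact ⟨_, ⟨_, rfl⟩, fun _ => ⟨v, hv, rfl⟩⟩
    · exact ⟨_, ⟨⟨0, by omega⟩, rfl⟩, fun hv' => (hv hv').elim⟩
  choose P hPJ hP using hP
  have hPJ' : ∀ c E i, P c E ≠ J i := by
    intro c E i
    obtain ⟨j, hj⟩ := hPJ c E
    rw [← hj]
    exact hπJ c j i
  let pos (a : (Fin m → ZMod q) × (Fin m → ZMod q)) : Fin m := P (a.1 ∘ J) {i | a.1 i = a.2 i}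
  let T (z : ZMod q) (a : (Fin m → ZMod q) × (Fin m → ZMod q)) :
      (Fin m → ZMod q) × (Fin m → ZMod q) :=
    (a.1 + Pi.single (pos a) z, a.2 + Pi.single (pos a) z)
  have hposT : ∀ z a, pos (T z a) = pos a := by
    intro z a
    simp only [pos, T, Pi.add_apply, add_left_inj]
    rw [comp_add_single (hPJ' _ _)]
  refine sum_eq_zero_of_sum_shift T (fun z => ?_) _ fun a => ?_
  · refine Finite.injective_iff_bijective.1 fun a b hab => ?_
    have hp : pos a = pos b := by rw [← hposT z a, hab, hposT]
    have h1 := congrArg Prod.fst hab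
    have h2 := congrArg Prod.snd hab
    simp only [T, hp] at h1 h2
    exact Prod.ext (add_right_cancel h1) (add_right_cancel h2)
  · obtain ⟨x, y⟩ := a
    by_cases hxy : x ∘ J = y ∘ J
    swap
    · refine Finset.sum_eq_zero fun z _ => if_neg fun hc => hxy ?_
      have := ((indexDigits_eq_iff hn J πc _ _).1 hc.2).1
      simpa only [T, pos, comp_add_single (hPJ' _ _)] using this
    have hcond : ∀ z, indexDigits hn J πc (T z (x, y)).1 = indexDigits hn J πc (T z (x, y)).2 ↔
        x (πc (x ∘ J) ⟨0, by omega⟩) = y (πc (x ∘ J) ⟨0, by omega⟩) := by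
      intro z
      rw [indexDigits_eq_iff]
      simp only [T, pos, comp_add_single (hPJ' _ _), hxy, true_and, Pi.add_apply, add_left_inj]
    simp only [hcond]
    by_cases h0 : x (πc (x ∘ J) ⟨0, by omega⟩) = y (πc (x ∘ J) ⟨0, by omega⟩)
    swap
    · simp [h0]
    by_cases hne : x = y
    · refine Finset.sum_eq_zero fun z _ => if_neg fun hc => hτ ?_
      rw [← hc.1]
      simp [T, hne]
    have hex : ∃ k : ℕ, ∃ hk : k < m - n, x (πc (x ∘ J) ⟨k, hk⟩) ≠ y (πc (x ∘ J) ⟨k, hk⟩) := by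
      obtain ⟨p, hp⟩ := Function.ne_iff.1 hne
      obtain ⟨j, rfl⟩ := exists_eq_of_forall_ne hn hJ (hπ (x ∘ J)) (hπJ (x ∘ J)) (p := p)
        (by rintro i rfl; exact hp (congrFun hxy i))
      exact ⟨j, j.isLt, hp⟩
    obtain ⟨hk, hkne⟩ := Nat.find_spec hex
    have hmin : ∀ j : Fin (m - n), (j : ℕ) < Nat.find hex →
        x (πc (x ∘ J) j) = y (πc (x ∘ J) j) := by
      intro j hj
      by_contra hc
      exact Nat.find_min hex hj ⟨j.isLt, hc⟩
    generalize Nat.find hex = k at hk hkne hmin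
    obtain _ | k := k
    · exact (hkne h0).elim
    obtain ⟨v, ⟨hv1, hv2⟩, hv⟩ := hP (x ∘ J) {i | x i = y i}
      ⟨⟨k, by omega⟩, fun j hj => hmin j (Nat.lt_succ_of_le hj), hkne⟩
    have hv3 : h' v (x (πc (x ∘ J) ⟨v + 1, by omega⟩))
        - h' v (y (πc (x ∘ J) ⟨v + 1, by omega⟩)) ≠ 0 :=
      sub_ne_zero.2 fun e => hv2 ((hh v).2.1 e)
    have hpos : pos (x, y) = πc (x ∘ J) ⟨v, by omega⟩ := hv
    have hT : ∀ z, T z (x, y) = (x + Pi.single (πc (x ∘ J) ⟨v, by omega⟩) z,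
        y + Pi.single (πc (x ∘ J) ⟨v, by omega⟩) z) := by
      intro z
      simp only [T, hpos]
    simp only [hT, h0, and_true,
      digitEquiv_sub_shift (show x (πc (x ∘ J) ⟨v, by omega⟩) = y (πc (x ∘ J) ⟨v, by omega⟩)
        from hv1 ⟨v, by omega⟩ le_rfl)]
    by_cases hd : ((digitEquiv q m y : ℕ) : ℤ) - (digitEquiv q m x : ℕ) = τ
    swap
    · simp [hd]
    simp only [hd, if_true, phase_sub_shift hn h h' g hπ hπJ s s' r r' hxy v hv1, sub_mul,
      AddChar.map_add_eq_mul, AddChar.map_sub_eq_div]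
    rw [← Finset.mul_sum, ← Finset.sum_div]
    generalize h' v (x (πc (x ∘ J) ⟨v + 1, by omega⟩))
      - h' v (y (πc (x ∘ J) ⟨v + 1, by omega⟩)) = δ at hv3
    rw [(AddGroup.addLeft_bijective (x (πc (x ∘ J) ⟨v, by omega⟩))).sum_comp
      fun w => (ZMod.stdAddChar (h v w * δ) : ℂ), sum_stdAddChar_comp_mul (hh v).1 hv3]
    simp

theorem isCCC_psiR (hm : 2 ≤ m) (hn : n < m) {J : Fin n → Fin m}
    (hJ : Function.Injective J) {h h' : Fin (m - n - 1) → ZMod q → ZMod q}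
    (hh : ∀ i, Function.Bijective (h i) ∧ Function.Bijective (h' i))
    (g : (Fin n → ZMod q) → Fin (m - n) → ZMod q → ZMod q)
    {πc : (Fin n → ZMod q) → Fin (m - n) → Fin m}
    (hπ : ∀ c, Function.Injective (πc c)) (hπJ : ∀ c i j, πc c i ≠ J j) :
    IsCCC (q ^ m) (fun t : Fin (q ^ (n + 1)) => psiR q m n hm hn J h h' g πc t.val) := by
  refine ⟨by simp, fun t t' τ _ => ?_⟩
  rw [codeACCF_psiR]
  by_cases hτ : τ = 0
  swap
  · rw [if_neg (fun hc => hτ hc.1),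
      sum_stdAddChar_phase_pairs_eq_zero hn hJ hh g hπ hπJ _ _ _ _ hτ, mul_zero]
  subst hτ
  have hdiag : ∀ x y : Fin m → ZMod q,
      (((digitEquiv q m y : ℕ) : ℤ) - (digitEquiv q m x : ℕ) = 0
        ∧ indexDigits hn J πc x = indexDigits hn J πc y) ↔ x = y := by
    intro x y
    constructor
    · rintro ⟨hd, -⟩
      exact (digitEquiv q m).injective (Fin.ext (by omega))
    · rintro rfl
      simp
  simp only [Fintype.sum_prod_type, hdiag, Finset.sum_ite_eq, Finset.mem_univ, if_true, true_and]
  split_ifs with htt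
  · subst htt
    simp
  · rw [sum_stdAddChar_phase_sub_eq_zero hn hJ h h' g hπJ, mul_zero]
    rintro ⟨hs, hr⟩
    refine htt (Fin.ext (eq_of_dig_eq t.isLt t'.isLt fun i hi => ?_))
    obtain _ | i := i
    · exact hr
    · have := congrFun hs ⟨n - (i + 1), by omega⟩
      simpa only [show n - (n - (i + 1)) = i + 1 by omega] using this

end Sufficiency

section Necessity

variable {q m n : ℕ}

/-- The coefficient of `k(j, z)` in `∑_j (k(j, u_j) − k(j, w_j))`. -/
def indicatorDiff {N : ℕ} (u w : Fin N → ZMod q) (p : Fin N × ZMod q) : ZMod q :=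
  (if p.2 = u p.1 then 1 else 0) - (if p.2 = w p.1 then 1 else 0)

lemma eq_or_eq_of_indicatorDiff_eq (hq : 2 ≤ q) {N : ℕ} {u w u₀ w₀ : Fin N → ZMod q}
    (H : indicatorDiff u w = indicatorDiff u₀ w₀) (j : Fin N) :
    (u₀ j = w₀ j → u j = w j) ∧
      (u₀ j ≠ w₀ j → (u j = u₀ j ∧ w j = w₀ j) ∨ (u j = w₀ j ∧ w j = u₀ j)) := by
  have : Fact (1 < q) := ⟨hq⟩
  constructor
  · intro h0
    have := congrFun H (j, u j)
    simp only [indicatorDiff, h0, if_true, sub_self] at this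
    by_contra hne
    simp [hne] at this
  · intro h0
    have h1 := congrFun H (j, u₀ j)
    have h2 := congrFun H (j, w₀ j)
    simp only [indicatorDiff, if_true, h0, h0.symm, if_false] at h1 h2
    by_cases hu : u₀ j = u j
    · left
      refine ⟨hu.symm, ?_⟩
      by_contra hw
      have e1 : w₀ j ≠ w j := fun e => hw e.symm
      have e2 : w₀ j ≠ u j := fun e => h0 (hu.trans e.symm)
      simp [e1, e2] at h2
    · right
      have hw : u₀ j = w j := by
        by_contra hw
        simp [hu, hw] at h1
      refine ⟨?_, hw.symm⟩
      by_contra hu'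
      have e1 : w₀ j ≠ u j := fun e => hu' e.symm
      have e2 : w₀ j ≠ w j := fun e => h0 (hw.trans e.symm)
      simp [e1, e2] at h2

variable [NeZero q]

lemma sum_mul_indicatorDiff {N : ℕ} (k : Fin N × ZMod q → ZMod q) (u w : Fin N → ZMod q) :
    ∑ p, k p * indicatorDiff u w p = ∑ j, k (j, u j) - ∑ j, k (j, w j) := by
  simp [indicatorDiff, Fintype.sum_prod_type, mul_sub, Finset.sum_sub_distrib]

lemma digitEquiv_sub_of_comp_eq (hn : n < m) {J : Fin n → Fin m} (hJ : Function.Injective J)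
    {π : Fin (m - n) → Fin m} (hπ : Function.Injective π) (hπJ : ∀ i j, π i ≠ J j)
    {x y : Fin m → ZMod q} (hxy : x ∘ J = y ∘ J) :
    ((digitEquiv q m y : ℕ) : ℤ) - (digitEquiv q m x : ℕ)
      = ∑ j, (((y (π j)).val : ℤ) - (x (π j)).val) * (q : ℤ) ^ (π j : ℕ) := by
  rw [digitEquiv_sub, ← (sumElim_bijective hn hJ hπ hπJ).sum_comp, Fintype.sum_sum_type]
  have h0 : ∀ i, y (J i) = x (J i) := fun i => (congrFun hxy i).symm
  simp [h0]

/-- Averaging over all choices of the functions `g` isolates the pairs of digit vectors whose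
indicator differences agree with a prescribed one. -/
lemma sum_pairs_eq_zero_of_forall (hn : n < m) (J : Fin n → Fin m)
    (h h' : Fin (m - n - 1) → ZMod q → ZMod q) (π : Fin (m - n) → Fin m) (τ : ℤ)
    (H : ∀ k : Fin (m - n) × ZMod q → ZMod q,
      (∑ a : (Fin m → ZMod q) × (Fin m → ZMod q),
        if ((digitEquiv q m a.2 : ℕ) : ℤ) - (digitEquiv q m a.1 : ℕ) = τ
            ∧ indexDigits hn J (fun _ => π) a.1 = indexDigits hn J (fun _ => π) a.2 then
          (ZMod.stdAddChar
            (phase hn J h h' (fun _ j z => k (j, z)) (fun _ => π) 0 0 a.1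
              - phase hn J h h' (fun _ j z => k (j, z)) (fun _ => π) 0 0 a.2) : ℂ)
        else 0) = 0) (u₀ w₀ : Fin (m - n) → ZMod q) :
    (∑ a : (Fin m → ZMod q) × (Fin m → ZMod q),
        if (((digitEquiv q m a.2 : ℕ) : ℤ) - (digitEquiv q m a.1 : ℕ) = τ
            ∧ indexDigits hn J (fun _ => π) a.1 = indexDigits hn J (fun _ => π) a.2)
            ∧ indicatorDiff (a.1 ∘ π) (a.2 ∘ π) = indicatorDiff u₀ w₀ then
          (ZMod.stdAddChar (chainSum h h' (a.1 ∘ π) - chainSum h h' (a.2 ∘ π)) : ℂ)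
        else 0) = 0 := by
  have h0 : ∑ k : Fin (m - n) × ZMod q → ZMod q,
      (ZMod.stdAddChar (-∑ p, k p * indicatorDiff u₀ w₀ p) : ℂ)
        * (∑ a : (Fin m → ZMod q) × (Fin m → ZMod q),
        if ((digitEquiv q m a.2 : ℕ) : ℤ) - (digitEquiv q m a.1 : ℕ) = τ
            ∧ indexDigits hn J (fun _ => π) a.1 = indexDigits hn J (fun _ => π) a.2 then
          (ZMod.stdAddChar
            (phase hn J h h' (fun _ j z => k (j, z)) (fun _ => π) 0 0 a.1
              - phase hn J h h' (fun _ j z => k (j, z)) (fun _ => π) 0 0 a.2) : ℂ)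
        else 0) = 0 :=
    Finset.sum_eq_zero fun k _ => by rw [H k, mul_zero]
  simp only [Finset.mul_sum] at h0
  rw [Finset.sum_comm] at h0
  have hQ : (q : ℂ) ^ Fintype.card (Fin (m - n) × ZMod q) ≠ 0 :=
    pow_ne_zero _ (Nat.cast_ne_zero.2 (NeZero.ne q))
  refine (mul_eq_zero.1 ?_).resolve_left hQ
  refine Eq.trans ?_ h0
  rw [Finset.mul_sum]
  refine Finset.sum_congr rfl fun a _ => ?_
  by_cases hc : ((digitEquiv q m a.2 : ℕ) : ℤ) - (digitEquiv q m a.1 : ℕ) = τ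
      ∧ indexDigits hn J (fun _ => π) a.1 = indexDigits hn J (fun _ => π) a.2
  swap
  · simp [hc]
  simp only [hc, if_true, true_and, and_true]
  have hJ : a.1 ∘ J = a.2 ∘ J := ((indexDigits_eq_iff hn J _ _ _).1 hc.2).1
  have e : ∀ k : Fin (m - n) × ZMod q → ZMod q,
      (ZMod.stdAddChar (-∑ p, k p * indicatorDiff u₀ w₀ p) : ℂ)
        * ZMod.stdAddChar (phase hn J h h' (fun _ j z => k (j, z)) (fun _ => π) 0 0 a.1
              - phase hn J h h' (fun _ j z => k (j, z)) (fun _ => π) 0 0 a.2)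
      = ZMod.stdAddChar (chainSum h h' (a.1 ∘ π) - chainSum h h' (a.2 ∘ π))
        * ZMod.stdAddChar
          (∑ p, k p * (indicatorDiff (a.1 ∘ π) (a.2 ∘ π) - indicatorDiff u₀ w₀) p) := by
    intro k
    rw [← AddChar.map_add_eq_mul, ← AddChar.map_add_eq_mul]
    congr 1
    simp only [Pi.sub_apply, mul_sub, Finset.sum_sub_distrib,
      sum_mul_indicatorDiff k (a.1 ∘ π) (a.2 ∘ π)]
    simp only [phase, hJ, Pi.zero_apply, zero_mul, Finset.sum_const_zero, add_zero,
      Function.comp_apply]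
    ring
  simp only [e]
  rw [← Finset.mul_sum, sum_stdAddChar_dotProduct]
  simp only [sub_eq_zero]
  split_ifs
  · ring
  · simp

lemma sum_stdAddChar_chain_eq_zero (hq : 2 ≤ q) (hn : n < m) {J : Fin n → Fin m}
    (hJ : Function.Injective J) (h h' : Fin (m - n - 1) → ZMod q → ZMod q)
    {π : Fin (m - n) → Fin m} (hπ : Function.Injective π) (hπJ : ∀ i j, π i ≠ J j)
    (H : ∀ (k : Fin (m - n) × ZMod q → ZMod q) (τ : ℤ), τ ≠ 0 → |τ| < (q ^ m : ℕ) →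
      (∑ a : (Fin m → ZMod q) × (Fin m → ZMod q),
        if ((digitEquiv q m a.2 : ℕ) : ℤ) - (digitEquiv q m a.1 : ℕ) = τ
            ∧ indexDigits hn J (fun _ => π) a.1 = indexDigits hn J (fun _ => π) a.2 then
          (ZMod.stdAddChar
            (phase hn J h h' (fun _ j z => k (j, z)) (fun _ => π) 0 0 a.1
              - phase hn J h h' (fun _ j z => k (j, z)) (fun _ => π) 0 0 a.2) : ℂ)
        else 0) = 0) (v : Fin (m - n - 1)) {a b : ZMod q} (hab : a.val < b.val) :
    ∑ z, ZMod.stdAddChar (h v z * (h' v a - h' v b)) = (0 : ℂ) := by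
  have : Fact (1 < q) := ⟨hq⟩
  let u₀ (j : Fin (m - n)) : ZMod q := if (j : ℕ) = v + 1 then a else 0
  let w₀ (j : Fin (m - n)) : ZMod q :=
    if (j : ℕ) = v + 1 then b else if (j : ℕ) ≤ v then 0 else 1
  have hle : ∀ j : Fin (m - n), (j : ℕ) ≤ v → u₀ j = w₀ j := by
    intro j hj
    simp [u₀, w₀, hj, show (j : ℕ) ≠ v + 1 by omega]
  have hlt : ∀ j : Fin (m - n), (v : ℕ) < j → (u₀ j).val < (w₀ j).val := by
    intro j hj
    by_cases hj' : (j : ℕ) = v + 1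
    · simpa [u₀, w₀, hj'] using hab
    · simp [u₀, w₀, hj', show ¬ (j : ℕ) ≤ v by omega, ZMod.val_one]
  have hne₀ : ∀ j : Fin (m - n), (v : ℕ) < j → u₀ j ≠ w₀ j := fun j hj e =>
    (hlt j hj).ne (congrArg ZMod.val e)
  let x₀ : Fin m → ZMod q := Function.extend π u₀ 0
  let y₀ : Fin m → ZMod q := Function.extend π w₀ 0
  have hx₀ : ∀ j, x₀ (π j) = u₀ j := fun j => hπ.extend_apply _ _ _
  have hy₀ : ∀ j, y₀ (π j) = w₀ j := fun j => hπ.extend_apply _ _ _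
  have hJ₀ : x₀ ∘ J = y₀ ∘ J := by
    funext i
    have : ¬ ∃ j, π j = J i := fun ⟨j, hj⟩ => hπJ j i hj
    simp [x₀, y₀, Function.extend_apply' _ _ _ this]
  let τ : ℤ := ((digitEquiv q m y₀ : ℕ) : ℤ) - (digitEquiv q m x₀ : ℕ)
  have hτ0 : τ ≠ 0 := by
    intro e
    have e' : x₀ = y₀ := (digitEquiv q m).injective (Fin.ext (by simp only [τ] at e; omega))
    refine hne₀ ⟨v + 1, by omega⟩ (Nat.lt_succ_self _) ?_
    rw [← hx₀, ← hy₀, e']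
  have hτL : |τ| < (q ^ m : ℕ) := by
    have h1 := (digitEquiv q m x₀).isLt
    have h2 := (digitEquiv q m y₀).isLt
    rw [abs_lt]
    constructor <;> simp only [τ] <;> omega
  have h0 := sum_pairs_eq_zero_of_forall hn J h h' π τ (fun k => H k τ hτ0 hτL) u₀ w₀
  let Q (c : (Fin m → ZMod q) × (Fin m → ZMod q)) : Prop :=
    c.1 ∘ J = c.2 ∘ J ∧ (∀ j : Fin (m - n), (j : ℕ) ≤ v → c.1 (π j) = c.2 (π j)) ∧
      ∀ j : Fin (m - n), (v : ℕ) < j → c.1 (π j) = u₀ j ∧ c.2 (π j) = w₀ j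
  have hQ : ∀ c : (Fin m → ZMod q) × (Fin m → ZMod q),
      ((((digitEquiv q m c.2 : ℕ) : ℤ) - (digitEquiv q m c.1 : ℕ) = τ
            ∧ indexDigits hn J (fun _ => π) c.1 = indexDigits hn J (fun _ => π) c.2)
            ∧ indicatorDiff (c.1 ∘ π) (c.2 ∘ π) = indicatorDiff u₀ w₀) ↔ Q c := by
    rintro ⟨x, y⟩
    simp only [indexDigits_eq_iff, τ, digitEquiv_sub_of_comp_eq hn hJ hπ hπJ hJ₀, hx₀, hy₀]
    constructor
    · rintro ⟨⟨hd, hxyJ, -⟩, hi⟩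
      rw [digitEquiv_sub_of_comp_eq hn hJ hπ hπJ hxyJ] at hd
      have hcase := eq_or_eq_of_indicatorDiff_eq hq hi
      simp only [Function.comp_apply] at hcase
      have hqpos : ∀ j, (0 : ℤ) < (q : ℤ) ^ (π j : ℕ) := fun j =>
        pow_pos (by exact_mod_cast Nat.pos_of_neZero q) _
      have hterm := (Finset.sum_eq_sum_iff_of_le fun j _ => ?_).1 hd
      · refine ⟨hxyJ, fun j hj => (hcase j).1 (hle j hj), fun j hj => ?_⟩
        rcases (hcase j).2 (hne₀ j hj) with hc | hc
        · exact hc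
        · have e := mul_right_cancel₀ (hqpos j).ne' (hterm j (Finset.mem_univ j))
          rw [hc.1, hc.2] at e
          have := hlt j hj
          omega
      · refine mul_le_mul_of_nonneg_right ?_ (hqpos j).le
        rcases le_or_gt (j : ℕ) v with hj | hj
        · rw [(hcase j).1 (hle j hj), hle j hj]
          simp
        · rcases (hcase j).2 (hne₀ j hj) with hc | hc
          · rw [hc.1, hc.2]
          · rw [hc.1, hc.2]
            have := hlt j hj
            omega
    · rintro ⟨hxyJ, h1, h2⟩
      have hval : ∀ j, (x (π j) = u₀ j ∧ y (π j) = w₀ j)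
          ∨ (x (π j) = y (π j) ∧ u₀ j = w₀ j) := fun j =>
        (le_or_gt (j : ℕ) v).elim (fun hj => Or.inr ⟨h1 j hj, hle j hj⟩) fun hj => Or.inl (h2 j hj)
      refine ⟨⟨?_, hxyJ, h1 _ (Nat.zero_le _)⟩, ?_⟩
      · rw [digitEquiv_sub_of_comp_eq hn hJ hπ hπJ hxyJ]
        refine Finset.sum_congr rfl fun j _ => ?_
        rcases hval j with hc | hc
        · simp only [hc.1, hc.2]
        · simp only [hc.1, hc.2, sub_self]
      · funext ⟨j, z⟩
        simp only [indicatorDiff, Function.comp_apply]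
        rcases hval j with hc | hc
        · simp only [hc.1, hc.2]
        · simp only [hc.1, hc.2, sub_self]
  simp only [hQ] at h0
  have hchain : ∀ c, Q c → chainSum h h' (c.1 ∘ π) - chainSum h h' (c.2 ∘ π)
      = (chainSum h h' u₀ - chainSum h h' w₀ - h v (u₀ ⟨v, by omega⟩) * (h' v a - h' v b))
        + h v (c.1 (π ⟨v, by omega⟩)) * (h' v a - h' v b) := by
    rintro c ⟨-, h1, h2⟩
    rw [chainSum_sub h h' v (u := c.1 ∘ π) (w := c.2 ∘ π) h1 hle h2]
    have e1 : u₀ ⟨v + 1, by omega⟩ = a := by simp [u₀]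
    have e2 : w₀ ⟨v + 1, by omega⟩ = b := by simp [w₀]
    rw [e1, e2]
    simp only [Function.comp_apply]
    ring
  let φ (z : ZMod q) : ℂ := ZMod.stdAddChar (h v z * (h' v a - h' v b))
  have h1 : ∑ c, (if Q c then φ (c.1 (π ⟨v, by omega⟩)) else 0) = 0 := by
    have hu : (ZMod.stdAddChar (chainSum h h' u₀ - chainSum h h' w₀
        - h v (u₀ ⟨v, by omega⟩) * (h' v a - h' v b)) : ℂ) ≠ 0 :=
      ((ZMod.stdAddChar (N := q)).val_isUnit _).ne_zero
    refine (mul_eq_zero.1 ?_).resolve_left hu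
    refine Eq.trans ?_ h0
    rw [Finset.mul_sum]
    refine Finset.sum_congr rfl fun c _ => ?_
    split_ifs with hc
    · rw [hchain c hc, AddChar.map_add_eq_mul]
    · rw [mul_zero]
  have hQshift : ∀ (z : ZMod q) c, Q (c + (Pi.single (π ⟨v, by omega⟩) z,
      Pi.single (π ⟨v, by omega⟩) z)) ↔ Q c := by
    rintro z ⟨x, y⟩
    simp only [Q, Prod.fst_add, Prod.snd_add, comp_add_single (hπJ _), Pi.add_apply,
      add_left_inj]
    refine and_congr_right fun _ => and_congr_right fun _ => forall₂_congr fun j hj => ?_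
    have : π j ≠ π ⟨v, by omega⟩ := hπ.ne (Fin.ne_of_gt hj)
    simp [Pi.single_eq_of_ne this]
  have h2 : (∑ c, if Q c then (1 : ℂ) else 0) * ∑ z, φ z = 0 := by
    calc (∑ c, if Q c then (1 : ℂ) else 0) * ∑ z, φ z
        = ∑ c, ∑ z, if Q c then φ (c.1 (π ⟨v, by omega⟩) + z) else 0 := by
          rw [Finset.sum_mul]
          refine Finset.sum_congr rfl fun c _ => ?_
          split_ifs
          · rw [one_mul, (AddGroup.addLeft_bijective (c.1 (π ⟨v, by omega⟩))).sum_comp φ]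
          · simp
      _ = ∑ z : ZMod q, ∑ c, if Q c then φ (c.1 (π ⟨v, by omega⟩)) else 0 := by
          rw [Finset.sum_comm]
          refine Finset.sum_congr rfl fun z _ => ?_
          refine Eq.trans ?_ ((AddGroup.addRight_bijective ((Pi.single (π ⟨v, by omega⟩) z,
            Pi.single (π ⟨v, by omega⟩) z) : (Fin m → ZMod q) × (Fin m → ZMod q))).sum_comp
              fun c => if Q c then φ (c.1 (π ⟨v, by omega⟩)) else 0)
          simp only [hQshift, Prod.fst_add, Pi.add_apply, Pi.single_eq_same]
      _ = 0 := Finset.sum_eq_zero fun z _ => h1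
  refine (mul_eq_zero.1 h2).resolve_left ?_
  rw [Finset.sum_boole]
  refine Nat.cast_ne_zero.2 <| Finset.card_ne_zero.2 ⟨(x₀, y₀), ?_⟩
  refine Finset.mem_filter.2 ⟨Finset.mem_univ _, hJ₀, ?_, ?_⟩
  · intro j hj
    simp only [hx₀, hy₀, hle j hj]
  · intro j _
    exact ⟨hx₀ j, hy₀ j⟩

lemma exists_injective_forall_ne {J : Fin n → Fin m} (hJ : Function.Injective J) :
    ∃ π : Fin (m - n) → Fin m, Function.Injective π ∧ ∀ i j, π i ≠ J j := by
  have hcard : ((Finset.univ.image J)ᶜ).card = m - n := by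
    rw [Finset.card_compl, Finset.card_image_of_injective _ hJ]
    simp
  refine ⟨Finset.orderEmbOfFin _ hcard, (Finset.orderEmbOfFin _ hcard).injective,
    fun i j hij => ?_⟩
  have := Finset.orderEmbOfFin_mem _ hcard i
  rw [hij] at this
  simp at this

theorem bijective_of_isCCC_psiR (hq : 2 ≤ q) (hm : 2 ≤ m) (hn : n < m) {J : Fin n → Fin m}
    (hJ : Function.Injective J) {h h' : Fin (m - n - 1) → ZMod q → ZMod q}
    {π : Fin (m - n) → Fin m} (hπ : Function.Injective π) (hπJ : ∀ i j, π i ≠ J j)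
    (H : ∀ g, IsCCC (q ^ m)
      (fun t : Fin (q ^ (n + 1)) => psiR q m n hm hn J h h' g (fun _ => π) t.val))
    (v : Fin (m - n - 1)) : Function.Bijective (h v) ∧ Function.Bijective (h' v) := by
  refine bijective_of_sum_stdAddChar_sub fun a b hab =>
    sum_stdAddChar_chain_eq_zero hq hn hJ h h' hπ hπJ (fun k τ hτ hτL => ?_) v hab
  let t : Fin (q ^ (n + 1)) := ⟨0, pow_pos (Nat.pos_of_neZero q) _⟩
  have h0 := (H fun _ j z => k (j, z)).2 t t τ hτL
  rw [if_neg (fun hc => hτ hc.1), codeACCF_psiR] at h0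
  have hdig : ∀ i, dig q 0 i = 0 := by simp [dig]
  have h1 := (mul_eq_zero.1 h0).resolve_left (pow_ne_zero _ (Nat.cast_ne_zero.2 (NeZero.ne q)))
  simp only [t, hdig] at h1
  exact h1

end Necessity

/-- Corollary 1: with `h_i, h'_i` fixed, the family
`{ψ(C_t) : 0 ≤ t < q^{n+1}}` is a `(q^{n+1}, q^m)`-CCC for every choice of the data
`(g^{(c)}_j)` and of the bijections `π_c : {1,…,m−n} → {1,…,m} \ J` iff every `h_i`
and every `h'_i` is a permutation of `ℤ_q`. -/
theorem stmt_10 (q m n : ℕ) [NeZero q] (hq : 2 ≤ q) (hm : 2 ≤ m) (hn : n < m)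
    (J : Fin n → Fin m) (hJ : Function.Injective J)
    (h h' : Fin (m - n - 1) → ZMod q → ZMod q) :
    (∀ (g : (Fin n → ZMod q) → Fin (m - n) → ZMod q → ZMod q)
        (πc : (Fin n → ZMod q) → Fin (m - n) → Fin m),
        (∀ c, Function.Injective (πc c) ∧ ∀ i j, πc c i ≠ J j) →
        IsCCC (q ^ m)
          (fun t : Fin (q ^ (n + 1)) => psiR q m n hm hn J h h' g πc t.val)) ↔
      ∀ i : Fin (m - n - 1), Function.Bijective (h i) ∧ Function.Bijective (h' i) := by
  constructor
  · intro H
    obtain ⟨π, hπ, hπJ⟩ := exists_injective_forall_ne hJ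
    exact bijective_of_isCCC_psiR hq hm hn hJ hπ hπJ fun g => H g _ fun _ => ⟨hπ, hπJ⟩
  · intro hh g πc hπc
    exact isCCC_psiR hm hn hJ hh g (fun c => (hπc c).1) fun c => (hπc c).2
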